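/- Let θ0 < θ1 be reals, σ > 0, and set L = (θ1−θ0)²/(2σ²). Define N0(γ,δ) = [(1−γ)·log(δ/(1−γ)) + γ·log((1−δ)/γ)] / (−L) and N1(γ,δ) = [δ·log(δ/(1−γ)) + (1−δ)·log((1−δ)/γ)] / L for 0 < γ, δ with γ + δ < 1. Then max{N0(γ,δ), N1(γ,δ)} / ((2σ²/(θ1−θ0)²)·|log(min{γ,δ})|) → 1 as (γ,δ) → (0,0) along pairs with 0 < γ ≤ δ. (This is the asymptotic expression for the average sample number of the SPRT with strength (γ,δ): E(T_SPRT) ∼ (2σ²/(θ1−θ0)²)·|log(γ∧δ)|.) -/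

import Mathlib

open Filter Real Topology

/-- Wald's approximation under `H1`, relative to `|log γ|`, is a perturbation of `1 - δ`. -/
lemma wald_alternative_div_neg_log {g d : ℝ} (hg : 0 < g) (hd : 0 < d) (hg1 : g < 1) (hd1 : d < 1) :
    (d * log (d / (1 - g)) + (1 - d) * log ((1 - d) / g)) / (-log g) =
      (1 - d) - ((1 - d) * log (1 - d) + d * log d - d * log (1 - g)) * (log g)⁻¹ := by
  have hlog : log g ≠ 0 := (log_neg hg hg1).ne
  rw [log_div hd.ne' (sub_pos.2 hg1).ne', log_div (sub_pos.2 hd1).ne' hg.ne']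
  field_simp
  ring

/-- For `γ ≤ δ`, Wald's approximation under `H0` is at most `|log γ|` up to a vanishing term. -/
lemma neg_wald_null_div_neg_log_le {g d : ℝ} (hg : 0 < g) (hgd : g ≤ d) (hg1 : g < 1)
    (hd1 : d < 1) :
    -((1 - g) * log (d / (1 - g)) + g * log ((1 - d) / g)) / (-log g) ≤
      1 + g * log (1 - d) * (log g)⁻¹ := by
  have hd : 0 < d := hg.trans_le hgd
  have hlog : log g < 0 := log_neg hg hg1
  have hlog_le : log g ≤ log d := log_le_log hg hgd
  have hlog_one_sub : log (1 - g) ≤ 0 := log_nonpos (sub_pos.2 hg1).le (by linarith)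
  rw [log_div hd.ne' (sub_pos.2 hg1).ne', log_div (sub_pos.2 hd1).ne' hg.ne',
    div_le_iff₀ (neg_pos.2 hlog)]
  have hcancel : (1 + g * log (1 - d) * (log g)⁻¹) * -log g = -log g - g * log (1 - d) := by
    field_simp [hlog.ne]
    ring
  rw [hcancel]
  nlinarith [mul_nonneg (sub_pos.2 hg1).le (sub_nonneg.2 hlog_le),
    mul_nonneg (sub_pos.2 hg1).le (neg_nonneg.2 hlog_one_sub)]

/-- **Asymptotic average sample number of the SPRT with strength `(γ,δ)`.**
With `N0`, `N1` Wald's ASN formulas under `H0` and `H1` and `L = (θ1−θ0)²/(2σ²)`,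
`max{N0(γ,δ), N1(γ,δ)} / ((2σ²/(θ1−θ0)²)·|log(γ∧δ)|) → 1` as `(γ,δ) → (0,0)`
along pairs with `0 < γ ≤ δ` (and `γ + δ < 1`); that is,
`E(T_SPRT) ∼ (2σ²/(θ1−θ0)²)·|log(γ∧δ)|`. -/
theorem SPRT_ASN_asymptotic
    (θ0 θ1 σ : ℝ) (hθ : θ0 < θ1) (hσ : 0 < σ)
    (L : ℝ) (hL : L = (θ1 - θ0) ^ 2 / (2 * σ ^ 2))
    (N0 N1 : ℝ → ℝ → ℝ)
    (hN0 : ∀ γ δ : ℝ,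
      N0 γ δ = ((1 - γ) * Real.log (δ / (1 - γ)) + γ * Real.log ((1 - δ) / γ)) / (-L))
    (hN1 : ∀ γ δ : ℝ,
      N1 γ δ = (δ * Real.log (δ / (1 - γ)) + (1 - δ) * Real.log ((1 - δ) / γ)) / L) :
    Tendsto (fun p : ℝ × ℝ =>
        max (N0 p.1 p.2) (N1 p.1 p.2) /
          ((2 * σ ^ 2 / (θ1 - θ0) ^ 2) * (-Real.log (min p.1 p.2))))
      (𝓝[{p : ℝ × ℝ | 0 < p.1 ∧ p.1 ≤ p.2 ∧ p.1 + p.2 < 1}] (0 : ℝ × ℝ))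
      (𝓝 1) := by
  set s : Set (ℝ × ℝ) := {p | 0 < p.1 ∧ p.1 ≤ p.2 ∧ p.1 + p.2 < 1}
  have hLpos : 0 < L := by
    have := sub_pos.2 hθ
    rw [hL]
    positivity
  have hLinv : 2 * σ ^ 2 / (θ1 - θ0) ^ 2 = L⁻¹ := by rw [hL, inv_div]
  have hs : ∀ᶠ p in 𝓝[s] (0 : ℝ × ℝ), p ∈ s := eventually_mem_nhdsWithin
  have hfst : Tendsto (fun p : ℝ × ℝ => p.1) (𝓝[s] 0) (𝓝 0) :=
    (continuous_fst.tendsto (0 : ℝ × ℝ)).mono_left nhdsWithin_le_nhds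
  have hsnd : Tendsto (fun p : ℝ × ℝ => p.2) (𝓝[s] 0) (𝓝 0) :=
    (continuous_snd.tendsto (0 : ℝ × ℝ)).mono_left nhdsWithin_le_nhds
  have hinv : Tendsto (fun p : ℝ × ℝ => (log p.1)⁻¹) (𝓝[s] 0) (𝓝 0) :=
    tendsto_inv_atBot_zero.comp <| tendsto_log_nhdsGT_zero.comp <|
      tendsto_nhdsWithin_iff.2 ⟨hfst, hs.mono fun _ hp => hp.1⟩
  have hlog_one_sub : Tendsto (fun x : ℝ => log (1 - x)) (𝓝 0) (𝓝 0) := by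
    have : ContinuousAt (fun x : ℝ => log (1 - x)) 0 :=
      (continuousAt_const.sub continuousAt_id).log (by simp)
    simpa [ContinuousAt] using this
  have hmul_log : Tendsto (fun p : ℝ × ℝ => p.2 * log p.2) (𝓝[s] 0) (𝓝 0) := by
    simpa [Function.comp_def] using (continuous_mul_log.tendsto 0).comp hsnd
  have hlog1 := hlog_one_sub.comp hfst
  have hlog2 := hlog_one_sub.comp hsnd
  have hlower : Tendsto (fun p : ℝ × ℝ => (1 - p.2) - ((1 - p.2) * log (1 - p.2)
      + p.2 * log p.2 - p.2 * log (1 - p.1)) * (log p.1)⁻¹) (𝓝[s] 0) (𝓝 1) := by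
    simpa using (hsnd.const_sub 1).sub
      (((((hsnd.const_sub 1).mul hlog2).add hmul_log).sub (hsnd.mul hlog1)).mul hinv)
  have hupper : Tendsto (fun p : ℝ × ℝ => 1 + p.1 * log (1 - p.2) * (log p.1)⁻¹)
      (𝓝[s] 0) (𝓝 1) := by
    simpa using ((hfst.mul hlog2).mul hinv).const_add 1
  have hmax := hupper.max hlower
  rw [max_self] at hmax
  have hsplit : ∀ p ∈ s, max (N0 p.1 p.2) (N1 p.1 p.2) /
      ((2 * σ ^ 2 / (θ1 - θ0) ^ 2) * (-log (min p.1 p.2))) =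
      max (-((1 - p.1) * log (p.2 / (1 - p.1)) + p.1 * log ((1 - p.2) / p.1)) / (-log p.1))
        ((1 - p.2) - ((1 - p.2) * log (1 - p.2) + p.2 * log p.2 - p.2 * log (1 - p.1))
          * (log p.1)⁻¹) := by
    rintro ⟨g, d⟩ ⟨hg, hgd, hsum⟩
    dsimp only at hg hgd hsum ⊢
    have hlog : 0 < -log g := neg_pos.2 (log_neg hg (by linarith))
    rw [← wald_alternative_div_neg_log hg (hg.trans_le hgd) (by linarith) (by linarith),
      min_eq_left hgd, hLinv, hN0, hN1, max_div_div_right hlog.le, div_neg, ← neg_div,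
      max_div_div_right hLpos.le]
    field_simp
  refine tendsto_of_tendsto_of_tendsto_of_le_of_le' hlower hmax ?_ ?_
  · filter_upwards [hs] with p hp
    rw [hsplit p hp]
    exact le_max_right _ _
  · filter_upwards [hs] with p hp
    rw [hsplit p hp]
    obtain ⟨hg, hgd, hsum⟩ := hp
    exact max_le_max_right _
      (neg_wald_null_div_neg_log_le hg hgd (by linarith) (by linarith))
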